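/- Let P be a simplicial poset and let y ∈ P with y ≠ 0̂. Then there is an isomorphism of reduced/relative cohomology groups H̃^{i − |supp(y)| − 1}(lk_P(y)) ≅ H^{i−1}(P, cost_P(y)) for all i, with coefficients in a field k. -/

import Mathlib

open scoped Classical
noncomputable section
variable (k : Type) [Field k]

section Cohomology
variable (Q : Type) [Fintype Q] [PartialOrder Q]

/-- The simplicial coboundary operator of a complex `K` of finite chains in a poset `Q`
(each face being a chain is canonically oriented by the order of `Q`):
`(δf)(s) = Σ_{v ∈ s} (-1)^{|{u ∈ s : u < v}|} f(s \ {v})` for `s ∈ K`, and `0` otherwise. -/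
def cDelta (K : Set (Finset Q)) : (Finset Q → k) →ₗ[k] (Finset Q → k) :=
  LinearMap.pi fun s =>
    if s ∈ K then
      ∑ v ∈ s, ((-1 : k) ^ ((s.filter fun u => u < v).card)) • LinearMap.proj (s.erase v)
    else 0

/-- Cochains of (cohomological) degree `i`: functions supported on faces of `K` with
`i + 1` vertices. -/
def cGraded (K : Set (Finset Q)) (i : ℤ) : Submodule k (Finset Q → k) :=
  Submodule.pi Set.univ fun s => if s ∈ K ∧ (s.card : ℤ) = i + 1 then ⊤ else ⊥

/-- Degree-`i` cocycles. -/
def ZC (K : Set (Finset Q)) (i : ℤ) : Submodule k (Finset Q → k) :=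
  LinearMap.ker (cDelta k Q K) ⊓ cGraded k Q K i

/-- Degree-`i` coboundaries. -/
def BC (K : Set (Finset Q)) (i : ℤ) : Submodule k (Finset Q → k) :=
  Submodule.map (cDelta k Q K) (cGraded k Q K (i - 1))

/-- The degree-`i` cohomology (with coefficients in `k`) of a complex `K` of chains
in `Q`. -/
abbrev Coh (K : Set (Finset Q)) (i : ℤ) :=
  ↥(ZC k Q K i) ⧸ Submodule.comap (ZC k Q K i).subtype (BC k Q K i)

/-- The full complex of chains of `Q` minus its minimal elements: the order complex
`Δ(Q̄)` (including the empty face, so `Coh` of it is *reduced* cohomology). -/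
def chainsK : Set (Finset Q) :=
  {s | (∀ q ∈ s, ¬ IsMin q) ∧ IsChain (· ≤ ·) (↑s : Set Q)}

/-- Reduced cohomology `H̃^i(Q)` of (the order complex of) a poset `Q`. -/
abbrev ReducedCoh (i : ℤ) := Coh k Q (chainsK Q) i

/-- The relative complex of the pair `(Q, R)` for a subset `R ⊆ Q`: faces of the order
complex of `Q` not lying in `R`; `Coh` of it is the relative cohomology `H^i(Q, R)`. -/
def relK (R : Set Q) : Set (Finset Q) :=
  {s | s ∈ chainsK Q ∧ ¬ (↑s : Set Q) ⊆ R}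

/-- Relative cohomology `H^i(Q, R)`. -/
abbrev RelCoh (R : Set Q) (i : ℤ) := Coh k Q (relK Q R) i

/-- The link of a face `F` of the order complex of `Q`. -/
def linkK (F : Finset Q) : Set (Finset Q) :=
  {s | (∀ q ∈ s, q ∉ F) ∧ (∀ q ∈ s ∪ F, ¬ IsMin q) ∧
    IsChain (· ≤ ·) (↑(s ∪ F) : Set Q)}
end Cohomology

/-- The contrastar `cost_P(y) = {z : ¬ y ≤ z}`. -/
def cost {P : Type} [PartialOrder P] (y : P) : Set P := {z | ¬ y ≤ z}

def IsSimplicialPoset (P : Type*) [Fintype P] [PartialOrder P] [OrderBot P] : Prop :=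
  ∀ y : P, ∃ m : ℕ, Nonempty (Set.Icc (⊥ : P) y ≃o Finset (Fin m))

section Generic
variable {k}
variable {Q : Type} [Fintype Q] [PartialOrder Q]

theorem cDelta_apply_mem {K : Set (Finset Q)} {s : Finset Q} (hs : s ∈ K) (f : Finset Q → k) :
    cDelta k Q K f s = ∑ v ∈ s, (-1 : k) ^ ((s.filter fun u => u < v).card) * f (s.erase v) := by
  simp [cDelta, hs]

theorem cDelta_apply_notMem {K : Set (Finset Q)} {s : Finset Q} (hs : s ∉ K) (f : Finset Q → k) :
    cDelta k Q K f s = 0 := by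
  simp [cDelta, hs]

theorem mem_cGraded {K : Set (Finset Q)} {i : ℤ} {f : Finset Q → k} :
    f ∈ cGraded k Q K i ↔ ∀ s, f s ≠ 0 → s ∈ K ∧ (s.card : ℤ) = i + 1 := by
  simp only [cGraded, Submodule.mem_pi, Set.mem_univ, true_imp_iff]
  refine forall_congr' fun s => ?_
  split_ifs with h
  · simp [h]
  · simp only [Submodule.mem_bot]
    tauto

theorem cDelta_mem {K : Set (Finset Q)} {i j : ℤ} (hij : j = i + 1) {f : Finset Q → k}
    (hf : f ∈ cGraded k Q K i) : cDelta k Q K f ∈ cGraded k Q K j := by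
  rw [mem_cGraded] at *
  intro s hs
  by_cases hK : s ∈ K
  · refine ⟨hK, ?_⟩
    rw [cDelta_apply_mem hK] at hs
    obtain ⟨v, hv, hne⟩ := Finset.exists_ne_zero_of_sum_ne_zero hs
    have h2 := (hf _ (right_ne_zero_of_mul hne)).2
    have h3 := Finset.card_erase_add_one hv
    omega
  · exact absurd (cDelta_apply_notMem hK f) hs

theorem sign_swap {s : Finset Q} {u v : Q} (hu : u ∈ s) (h : u < v) :
    (-1 : k) ^ ((s.filter fun w => w < v).card) *
        (-1 : k) ^ (((s.erase v).filter fun w => w < u).card) =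
      - ((-1 : k) ^ ((s.filter fun w => w < u).card) *
        (-1 : k) ^ (((s.erase u).filter fun w => w < v).card)) := by
  have h1 : (s.erase v).filter (fun w => w < u) = s.filter fun w => w < u := by
    ext w; simp only [Finset.mem_filter, Finset.mem_erase]
    constructor
    · tauto
    · rintro ⟨a, b⟩; exact ⟨⟨(b.trans h).ne, a⟩, b⟩
  have h2 : (s.erase u).filter (fun w => w < v) = (s.filter fun w => w < v).erase u := by
    ext w; simp only [Finset.mem_filter, Finset.mem_erase]; tauto
  have h3 : u ∈ s.filter fun w => w < v := by simp [hu, h]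
  have h4 := Finset.card_erase_add_one h3
  rw [h1, h2, ← h4, pow_succ]; ring

theorem cDelta_cDelta {K : Set (Finset Q)} (hch : ∀ s ∈ K, IsChain (· ≤ ·) (↑s : Set Q))
    (hconv : ∀ s ∈ K, ∀ t ∈ K, ∀ r, s ⊆ r → r ⊆ t → r ∈ K)
    {i : ℤ} {f : Finset Q → k} (hf : f ∈ cGraded k Q K i) :
    cDelta k Q K (cDelta k Q K f) = 0 := by
  rw [mem_cGraded] at hf
  funext s
  by_cases hK : s ∈ K
  swap
  · exact cDelta_apply_notMem hK _
  rw [cDelta_apply_mem hK]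
  have key : ∀ v ∈ s, (-1 : k) ^ ((s.filter fun u => u < v).card) * cDelta k Q K f (s.erase v)
      = ∑ u ∈ s.erase v, (-1 : k) ^ ((s.filter fun u => u < v).card) *
        ((-1 : k) ^ (((s.erase v).filter fun w => w < u).card) * f ((s.erase v).erase u)) := by
    intro v hv
    rw [← Finset.mul_sum]
    congr 1
    by_cases hv' : s.erase v ∈ K
    · rw [cDelta_apply_mem hv']
    · rw [cDelta_apply_notMem hv']
      symm
      refine Finset.sum_eq_zero fun u hu => ?_
      have : f ((s.erase v).erase u) = 0 := by
        by_contra h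
        exact hv' (hconv _ (hf _ h).1 _ hK _ (Finset.erase_subset _ _) (Finset.erase_subset _ _))
      rw [this]; simp
  rw [Finset.sum_congr rfl key, Finset.sum_sigma', Pi.zero_apply]
  refine Finset.sum_involution (fun a _ => ⟨a.2, a.1⟩) ?_ ?_ ?_ ?_
  · rintro ⟨v, u⟩ h
    simp only [Finset.mem_sigma, Finset.mem_erase] at h
    obtain ⟨hv, huv, hu⟩ := h
    dsimp only
    rw [Finset.erase_right_comm (a := u) (b := v), ← mul_assoc, ← mul_assoc]
    rcases hch s hK hu hv huv with h | h
    · rw [sign_swap hu (lt_of_le_of_ne h huv)]; ring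
    · rw [sign_swap (u := v) (v := u) hv (lt_of_le_of_ne h huv.symm)]; ring
  · rintro ⟨v, u⟩ h _ heq
    simp only [Finset.mem_sigma, Finset.mem_erase] at h
    simp only [Sigma.mk.injEq] at heq
    exact h.2.1 heq.1
  · rintro ⟨v, u⟩ h
    simp only [Finset.mem_sigma, Finset.mem_erase] at h ⊢
    exact ⟨h.2.2, Ne.symm h.2.1, h.1⟩
  · rintro ⟨v, u⟩ h; rfl

/-- Acyclicity of the part `L` of `K` carrying a filtered matching. -/
theorem acyclic_of_matching {K L : Set (Finset Q)}
    (hch : ∀ s ∈ K, IsChain (· ≤ ·) (↑s : Set Q))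
    (hconv : ∀ s ∈ K, ∀ t ∈ K, ∀ r, s ⊆ r → r ⊆ t → r ∈ K)
    (hLK : L ⊆ K) (r : Finset Q → ℕ) (v : Finset Q → Q)
    (ha : ∀ t ∈ L, ∀ u ∈ t, t.erase u ∈ K → t.erase u ∈ L ∧ r (t.erase u) ≤ r t)
    (hb : ∀ t ∈ L, v t ∈ t → t.erase (v t) ∈ L ∧ r (t.erase (v t)) = r t)
    (hc : ∀ s ∈ L, v s ∉ s → insert (v s) s ∈ L ∧ r (insert (v s) s) = r s)
    (hd : ∀ t ∈ L, ∀ u ∈ t, t.erase u ∈ L → r (t.erase u) = r t → v (t.erase u) = v t)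
    {i j : ℤ} (hij : j = i + 1) {f : Finset Q → k} (hf : f ∈ cGraded k Q K j)
    (hDf : ∀ s ∈ L, cDelta k Q K f s = 0) :
    ∃ b ∈ cGraded k Q K i, ∀ s ∈ L, f s = cDelta k Q K b s := by
  suffices h : ∀ N : ℕ, ∃ b ∈ cGraded k Q K i, ∀ s ∈ L, r s < N → f s = cDelta k Q K b s by
    obtain ⟨b, hb, h⟩ := h ((Finset.univ.sup r) + 1)
    exact ⟨b, hb, fun s hs => h s hs (Nat.lt_succ_of_le (Finset.le_sup (Finset.mem_univ s)))⟩
  intro N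
  induction N with
  | zero => exact ⟨0, Submodule.zero_mem _, fun s _ h => absurd h (Nat.not_lt_zero _)⟩
  | succ N ih =>
    obtain ⟨b, hbG, hbN⟩ := ih
    set f1 := f - cDelta k Q K b with hf1
    have hf1G : f1 ∈ cGraded k Q K j := Submodule.sub_mem _ hf (cDelta_mem hij hbG)
    have hDf1 : ∀ s ∈ L, cDelta k Q K f1 s = 0 := by
      intro s hs
      rw [hf1, map_sub, cDelta_cDelta hch hconv hbG, sub_zero]; exact hDf s hs
    have hf1N : ∀ s ∈ L, r s < N → f1 s = 0 := by
      intro s hs h; simp [hf1, hbN s hs h]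
    let b1 : Finset Q → k := fun s => if s ∈ L ∧ r s = N ∧ v s ∉ s then
      (-1 : k) ^ (((insert (v s) s).filter fun u => u < v s).card) * f1 (insert (v s) s) else 0
    have hb1 : ∀ s, b1 s ≠ 0 → s ∈ L ∧ r s = N ∧ v s ∉ s := by
      intro s hs
      by_contra h
      exact hs (if_neg h)
    have hb1G : b1 ∈ cGraded k Q K i := by
      rw [mem_cGraded] at hf1G ⊢
      intro s hs
      obtain ⟨h1, h2, h3⟩ := hb1 s hs
      refine ⟨hLK h1, ?_⟩
      simp only [b1, if_pos (⟨h1, h2, h3⟩ : s ∈ L ∧ r s = N ∧ v s ∉ s)] at hs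
      have := (hf1G _ (right_ne_zero_of_mul hs)).2
      rw [Finset.card_insert_of_notMem h3] at this
      push_cast at this; omega
    set f2 := f1 - cDelta k Q K b1 with hf2
    have hf2G : f2 ∈ cGraded k Q K j := Submodule.sub_mem _ hf1G (cDelta_mem hij hb1G)
    have hDf2 : ∀ s ∈ L, cDelta k Q K f2 s = 0 := by
      intro s hs
      rw [hf2, map_sub, cDelta_cDelta hch hconv hb1G, sub_zero]; exact hDf1 s hs
    have hlt : ∀ s ∈ L, r s < N → f2 s = 0 := by
      intro s hs h
      rw [hf2, Pi.sub_apply, hf1N s hs h, cDelta_apply_mem (hLK hs), zero_sub, neg_eq_zero]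
      refine Finset.sum_eq_zero fun u hu => ?_
      have : b1 (s.erase u) = 0 := by
        by_contra h0
        obtain ⟨h1, h2, h3⟩ := hb1 _ h0
        have := (ha s hs u hu (hLK h1)).2
        omega
      rw [this, mul_zero]
    have hup : ∀ t ∈ L, r t = N → v t ∈ t → f2 t = 0 := by
      intro t ht hr hv
      obtain ⟨hb1', hb2'⟩ := hb t ht hv
      rw [hf2, Pi.sub_apply, cDelta_apply_mem (hLK ht), Finset.sum_eq_single (v t)]
      · have hvv := hd t ht _ hv hb1' hb2'
        have : b1 (t.erase (v t)) =
            (-1 : k) ^ ((t.filter fun u => u < v t).card) * f1 t := by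
          have hcond : t.erase (v t) ∈ L ∧ r (t.erase (v t)) = N ∧
              v (t.erase (v t)) ∉ t.erase (v t) := by
            refine ⟨hb1', hb2'.trans hr, ?_⟩
            rw [hvv]; simp
          simp only [b1, if_pos hcond]
          rw [hvv, Finset.insert_erase hv]
        rw [this, ← mul_assoc, ← pow_add, ← two_mul, pow_mul]; simp
      · intro u hu hne
        have : b1 (t.erase u) = 0 := by
          by_contra h0
          obtain ⟨h1, h2, h3⟩ := hb1 _ h0
          rw [hd t ht u hu h1 (h2.trans hr.symm)] at h3
          exact h3 (Finset.mem_erase.2 ⟨hne.symm, hv⟩)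
        rw [this, mul_zero]
      · intro h; exact absurd hv h
    have hdown : ∀ s ∈ L, r s = N → v s ∉ s → f2 s = 0 := by
      intro s hs hr hv
      obtain ⟨hc1, hc2⟩ := hc s hs hv
      have h0 := hDf2 _ hc1
      have hmem : v s ∈ insert (v s) s := Finset.mem_insert_self _ _
      have her : (insert (v s) s).erase (v s) = s := Finset.erase_insert hv
      have hvt : v (insert (v s) s) = v s := by
        have := hd _ hc1 (v s) hmem (by rw [her]; exact hs) (by rw [her, hc2])
        rw [her] at this; exact this.symm
      rw [cDelta_apply_mem (hLK hc1), Finset.sum_eq_single (v s)] at h0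
      · rw [her] at h0
        exact (mul_eq_zero.1 h0).resolve_left (pow_ne_zero _ (by simp))
      · intro u hu hne
        have : f2 ((insert (v s) s).erase u) = 0 := by
          by_contra hne0
          have hK := (mem_cGraded.1 hf2G _ hne0).1
          obtain ⟨hL, hle⟩ := ha _ hc1 u hu hK
          rcases hle.lt_or_eq with h | h
          · exact hne0 (hlt _ hL (by omega))
          · have := hd _ hc1 u hu hL h
            refine hne0 (hup _ hL (by omega) ?_)
            rw [this, hvt]
            exact Finset.mem_erase.2 ⟨hne.symm, hmem⟩
        rw [this, mul_zero]
      · intro h; exact absurd hmem h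
    refine ⟨b + b1, Submodule.add_mem _ hbG hb1G, fun s hs hr => ?_⟩
    have h0 : f2 s = 0 := by
      rcases (Nat.lt_succ_iff.1 hr).lt_or_eq with h | h
      · exact hlt s hs h
      · by_cases hv : v s ∈ s
        · exact hup s hs h hv
        · exact hdown s hs h hv
    rw [hf2, hf1] at h0
    simp only [Pi.sub_apply] at h0
    rw [map_add, Pi.add_apply]
    linear_combination h0

/-- Extension by zero along a map of faces. -/
def extMap {Q' : Type} (U : Set (Finset Q)) (ψ : Finset Q → Finset Q') :
    (Finset Q' → k) →ₗ[k] (Finset Q → k) :=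
  LinearMap.pi fun t => if t ∈ U then LinearMap.proj (ψ t) else 0

theorem extMap_apply {Q' : Type} (U : Set (Finset Q)) (ψ : Finset Q → Finset Q')
    (f : Finset Q' → k) (t : Finset Q) : extMap U ψ f t = if t ∈ U then f (ψ t) else 0 := by
  simp only [extMap, LinearMap.pi_apply]
  split_ifs <;> simp

theorem coh_iso {Q' : Type} [Fintype Q'] [PartialOrder Q'] {K U : Set (Finset Q)}
    {K' : Set (Finset Q')}
    (hch : ∀ s ∈ K, IsChain (· ≤ ·) (↑s : Set Q))
    (hconv : ∀ s ∈ K, ∀ t ∈ K, ∀ r, s ⊆ r → r ⊆ t → r ∈ K)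
    (hUK : U ⊆ K) (ψ : Finset Q → Finset Q') (φ : Finset Q' → Finset Q) (d : ℤ)
    (hψ : ∀ t ∈ U, ψ t ∈ K' ∧ (t.card : ℤ) = (ψ t).card + d ∧ φ (ψ t) = t)
    (hφ : ∀ s ∈ K', φ s ∈ U ∧ ψ (φ s) = s)
    (c : k) (hc : c ≠ 0)
    (hD : ∀ f : Finset Q' → k, (∀ s, f s ≠ 0 → s ∈ K') →
      cDelta k Q K (extMap U ψ f) = c • extMap U ψ (cDelta k Q' K' f))
    (hac : ∀ (i j : ℤ), j = i + 1 → ∀ f ∈ cGraded k Q K j,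
      (∀ s ∈ K \ U, cDelta k Q K f s = 0) →
      ∃ b ∈ cGraded k Q K i, ∀ s ∈ K \ U, f s = cDelta k Q K b s)
    (i j : ℤ) (hij : j = i + d) :
    Nonempty (Coh k Q' K' i ≃ₗ[k] Coh k Q K j) := by
  have hsupp : ∀ {i : ℤ} {f : Finset Q' → k}, f ∈ cGraded k Q' K' i → ∀ s, f s ≠ 0 → s ∈ K' :=
    fun hf s hs => (mem_cGraded.1 hf s hs).1
  have hG : ∀ i j : ℤ, j = i + d → ∀ f ∈ cGraded k Q' K' i, extMap U ψ f ∈ cGraded k Q K j := by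
    intro i j hij f hf
    rw [mem_cGraded] at hf ⊢
    intro s hs
    rw [extMap_apply] at hs
    split_ifs at hs with h
    · have := (hf _ hs).2
      have := (hψ s h).2.1
      exact ⟨hUK h, by omega⟩
    · exact absurd rfl hs
  have hinj : ∀ f g : Finset Q' → k, (∀ s, f s ≠ 0 → s ∈ K') → (∀ s, g s ≠ 0 → s ∈ K') →
      extMap U ψ f = extMap U ψ g → f = g := by
    intro f g hf hg h
    funext s
    by_cases hs : s ∈ K'
    · have := congrFun h (φ s)
      simpa [extMap_apply, (hφ s hs).1, (hφ s hs).2] using this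
    · rw [not_imp_comm.1 (hf s) hs, not_imp_comm.1 (hg s) hs]
  have hsurj : ∀ i j : ℤ, j = i + d → ∀ g ∈ cGraded k Q K j, (∀ s ∈ K \ U, g s = 0) →
      ∃ f ∈ cGraded k Q' K' i, extMap U ψ f = g := by
    intro i j hij g hg h0
    rw [mem_cGraded] at hg
    refine ⟨fun s => if s ∈ K' then g (φ s) else 0, ?_, ?_⟩
    · rw [mem_cGraded]
      intro s hs
      split_ifs at hs with h
      · refine ⟨h, ?_⟩
        have h1 := (hg _ hs).2
        have h2 := (hψ _ (hφ s h).1).2.1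
        rw [(hφ s h).2] at h2
        omega
      · exact absurd rfl hs
    · funext t
      rw [extMap_apply]
      split_ifs with h h'
      · rw [(hψ t h).2.2]
      · exact absurd (hψ t h).1 h'
      · by_contra hne
        exact hne (h0 t ⟨(hg t (Ne.symm hne)).1, h⟩).symm
  have hDsupp : ∀ f : Finset Q' → k, ∀ s, cDelta k Q' K' f s ≠ 0 → s ∈ K' := by
    intro f s hs
    by_contra h
    exact hs (cDelta_apply_notMem h f)
  have hZ : ∀ f ∈ ZC k Q' K' i, extMap U ψ f ∈ ZC k Q K j := by
    rintro f ⟨h1, h2⟩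
    refine ⟨?_, hG i j hij f h2⟩
    have h1 : cDelta k Q' K' f = 0 := h1
    change cDelta k Q K _ = 0
    rw [hD f (hsupp h2), h1]; simp
  let g : ZC k Q' K' i →ₗ[k] Coh k Q K j :=
    (Submodule.mkQ _).comp ((extMap U ψ).restrict hZ)
  have hgs : Function.Surjective g := by
    intro q
    obtain ⟨⟨z, hz1, hz2⟩, rfl⟩ := Submodule.mkQ_surjective _ q
    have hz1 : cDelta k Q K z = 0 := hz1
    obtain ⟨b, hbG, hb⟩ := hac (j - 1) j (by ring) z hz2 (fun s _ => by rw [hz1]; rfl)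
    obtain ⟨f, hfG, hf⟩ := hsurj i j hij (z - cDelta k Q K b)
      (Submodule.sub_mem _ hz2 (cDelta_mem (by ring) hbG)) (fun s hs => by simp [hb s hs])
    have hfZ : f ∈ ZC k Q' K' i := by
      refine ⟨?_, hfG⟩
      change cDelta k Q' K' f = 0
      have h1 := hD f (hsupp hfG)
      rw [hf, map_sub, hz1, cDelta_cDelta hch hconv hbG, sub_zero] at h1
      have h2 : extMap U ψ (cDelta k Q' K' f) = 0 :=
        (smul_eq_zero.1 h1.symm).resolve_left hc
      exact hinj _ 0 (hDsupp f) (by simp) (by rw [h2, map_zero])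
    refine ⟨⟨f, hfZ⟩, ?_⟩
    change Submodule.Quotient.mk _ = Submodule.Quotient.mk _
    rw [Submodule.Quotient.eq]
    change extMap U ψ f - z ∈ BC k Q K j
    rw [hf]
    refine ⟨-b, Submodule.neg_mem _ hbG, ?_⟩
    rw [map_neg]; abel
  have hgk : Submodule.comap (ZC k Q' K' i).subtype (BC k Q' K' i) = LinearMap.ker g := by
    ext ⟨z, hz⟩
    have : (⟨z, hz⟩ : ZC k Q' K' i) ∈ LinearMap.ker g ↔ extMap U ψ z ∈ BC k Q K j := by
      rw [LinearMap.mem_ker]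
      change Submodule.Quotient.mk _ = _ ↔ _
      rw [Submodule.Quotient.mk_eq_zero]
      rfl
    rw [this]
    change z ∈ BC k Q' K' i ↔ _
    constructor
    · rintro ⟨e, he, rfl⟩
      refine ⟨c⁻¹ • extMap U ψ e, Submodule.smul_mem _ _ (hG (i - 1) (j - 1) (by omega) e he), ?_⟩
      rw [map_smul, hD e (hsupp he), smul_smul, inv_mul_cancel₀ hc, one_smul]
    · rintro ⟨b, hbG, hb⟩
      have hbG : b ∈ cGraded k Q K (j - 1) := hbG
      obtain ⟨e, heG, he⟩ := hac (j - 2) (j - 1) (by ring) b hbG (fun s hs => by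
        rw [hb, extMap_apply, if_neg hs.2])
      obtain ⟨f, hfG, hf⟩ := hsurj (i - 1) (j - 1) (by omega) (b - cDelta k Q K e)
        (Submodule.sub_mem _ hbG (cDelta_mem (by ring) heG)) (fun s hs => by simp [he s hs])
      refine ⟨c • f, Submodule.smul_mem _ _ hfG, ?_⟩
      have h1 := hD f (hsupp hfG)
      rw [hf, map_sub, cDelta_cDelta hch hconv heG, sub_zero, hb, ← map_smul, ← map_smul] at h1
      exact (hinj _ _ (hsupp hz.2) (hDsupp _) h1).symm
  exact ⟨(Submodule.quotEquivOfEq _ _ hgk).trans (g.quotKerEquivOfSurjective hgs)⟩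

end Generic

section Concrete
variable {k}
variable {P : Type} [Fintype P] [PartialOrder P]

/-- Chains in `P_{>x}` which, together with `x`, are not contained in the contrastar of `y`. -/
def KK (y x : P) : Set (Finset P) :=
  {s | (∀ q ∈ s, x < q) ∧ IsChain (· ≤ ·) (↑s : Set P) ∧ ∃ q ∈ insert x s, y ≤ q}

theorem KK_conv (y x : P) : ∀ s ∈ KK y x, ∀ t ∈ KK y x, ∀ r, s ⊆ r → r ⊆ t → r ∈ KK y x := by
  rintro s ⟨_, _, q, hq, hyq⟩ t ⟨ht1, ht2, _⟩ r hsr hrt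
  exact ⟨fun q hq => ht1 q (hrt hq), ht2.mono (by exact_mod_cast hrt),
    q, Finset.insert_subset_insert _ hsr hq, hyq⟩

/-- The smallest element of a chain above a given element. -/
def mins [OrderBot P] (x' : P) (s : Finset P) : P :=
  if h : ∃ m ∈ s, x' ≤ m ∧ ∀ z ∈ s, x' ≤ z → m ≤ z then h.choose else ⊥

theorem mins_eq [OrderBot P] {x' : P} {s : Finset P} {m : P} (hm : m ∈ s) (hx : x' ≤ m)
    (h : ∀ z ∈ s, x' ≤ z → m ≤ z) : mins x' s = m := by
  have hex : ∃ m ∈ s, x' ≤ m ∧ ∀ z ∈ s, x' ≤ z → m ≤ z := ⟨m, hm, hx, h⟩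
  rw [mins, dif_pos hex]
  have h2 := hex.choose_spec
  exact le_antisymm (h2.2.2 m hm hx) (h _ h2.1 h2.2.1)

theorem mins_spec [OrderBot P] {x' : P} {s : Finset P} (hs : IsChain (· ≤ ·) (↑s : Set P))
    (hex : ∃ q ∈ s, x' ≤ q) :
    mins x' s ∈ s ∧ x' ≤ mins x' s ∧ ∀ z ∈ s, x' ≤ z → mins x' s ≤ z := by
  obtain ⟨q, hq, hxq⟩ := hex
  obtain ⟨m, hm⟩ := (s.filter (x' ≤ ·)).exists_minimal ⟨q, by simp [hq, hxq]⟩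
  have hm1 := hm.1
  simp only [Finset.mem_filter] at hm1
  have h : ∀ z ∈ s, x' ≤ z → m ≤ z := by
    intro z hz hxz
    rcases hs.total hm1.1 hz with h | h
    · exact h
    · exact hm.2 (by simp [hz, hxz]) h
  rw [mins_eq hm1.1 hm1.2 h]
  exact ⟨hm1.1, hm1.2, h⟩

theorem exists_compl [OrderBot P] (hP : IsSimplicialPoset P) {x x' z : P} (hx : x ⋖ x')
    (hz : x' < z) : ∃ p, x < p ∧ p < z ∧ ¬ x' ≤ p ∧ ∀ q, x < q → q ≤ z → ¬ x' ≤ q → q ≤ p := by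
  obtain ⟨m, ⟨e⟩⟩ := hP z
  have hxz : x ≤ z := (hx.lt.trans hz).le
  set X := e ⟨x, bot_le, hxz⟩ with hX
  set X' := e ⟨x', bot_le, hz.le⟩ with hX'
  have hcov : X ⋖ X' := by
    rw [hX, hX', apply_covBy_apply_iff e]
    refine ⟨hx.lt, fun c h1 h2 => hx.2 (c := c.1) h1 h2⟩
  obtain ⟨a, ha, haX⟩ := Finset.covBy_iff_exists_insert.1 hcov
  have hle : ∀ q (hq : q ≤ z), x < q → (x' ≤ q ↔ a ∈ e ⟨q, bot_le, hq⟩) := by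
    intro q hq hxq
    have h1 : X ≤ e ⟨q, bot_le, hq⟩ := e.le_iff_le.2 hxq.le
    have h2 : x' ≤ q ↔ X' ≤ e ⟨q, bot_le, hq⟩ :=
      (e.le_iff_le (x := ⟨x', bot_le, hz.le⟩) (y := ⟨q, bot_le, hq⟩)).symm
    rw [h2, ← haX, Finset.le_iff_subset, Finset.insert_subset_iff]
    exact ⟨fun h => h.1, fun h => ⟨h, h1⟩⟩
  set p := e.symm (Finset.univ.erase a) with hp
  have hep : e ⟨p.1, bot_le, p.2.2⟩ = Finset.univ.erase a := by
    rw [hp]; exact e.apply_symm_apply _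
  have hXp : X ≤ Finset.univ.erase a := by
    intro b hb
    simp only [Finset.mem_erase, Finset.mem_univ, and_true]
    rintro rfl; exact ha hb
  have hxp : x ≤ p.1 := by
    have : (⟨x, bot_le, hxz⟩ : Set.Icc ⊥ z) ≤ p := by
      rw [← e.le_iff_le, hp, e.apply_symm_apply]; exact hXp
    exact this
  have hxp' : x < p.1 := by
    refine lt_of_le_of_ne hxp fun h => ?_
    have hXe : X = Finset.univ.erase a := by
      rw [← hep, hX]; congr 1; exact Subtype.ext h
    have : X' = Finset.univ := by rw [← haX, hXe, Finset.insert_erase (Finset.mem_univ a)]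
    have h2 : e ⟨z, bot_le, le_rfl⟩ ≤ X' := by rw [this]; exact Finset.subset_univ _
    have h3 : z ≤ x' := e.le_iff_le.1 h2
    exact absurd hz h3.not_gt
  have hxnp : ¬ x' ≤ p.1 := by
    rw [hle _ p.2.2 hxp', hep]; simp
  refine ⟨p.1, hxp', lt_of_le_of_ne p.2.2 ?_, hxnp, ?_⟩
  · intro h; exact hxnp (hz.le.trans h.ge)
  · intro q hxq hqz hn
    rw [hle q hqz hxq] at hn
    have : e ⟨q, bot_le, hqz⟩ ≤ e p := by
      rw [hp, e.apply_symm_apply]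
      intro b hb
      simp only [Finset.mem_erase, Finset.mem_univ, and_true]
      rintro rfl; exact hn hb
    exact e.le_iff_le.1 this

theorem step_acyclic [OrderBot P] (hP : IsSimplicialPoset P) {x x' y : P} (hx : x ⋖ x')
    (hy : x' ≤ y) {i j : ℤ} (hij : j = i + 1) {f : Finset P → k}
    (hf : f ∈ cGraded k P (KK y x) j)
    (hDf : ∀ s ∈ KK y x \ {t | t ∈ KK y x ∧ x' ∈ t}, cDelta k P (KK y x) f s = 0) :
    ∃ b ∈ cGraded k P (KK y x) i, ∀ s ∈ KK y x \ {t | t ∈ KK y x ∧ x' ∈ t},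
      f s = cDelta k P (KK y x) b s := by
  have hpex : ∀ z : P, ∃ p, x' < z →
      x < p ∧ p < z ∧ ¬ x' ≤ p ∧ ∀ q, x < q → q ≤ z → ¬ x' ≤ q → q ≤ p := by
    intro z
    by_cases h : x' < z
    · obtain ⟨p, hp⟩ := exists_compl hP hx h
      exact ⟨p, fun _ => hp⟩
    · exact ⟨⊥, fun h' => absurd h' h⟩
  choose p hp using hpex
  have hxy : ¬ y ≤ x := fun h => absurd (hx.lt.trans_le (hy.trans h)) (lt_irrefl x)
  have hL : KK y x \ {t | t ∈ KK y x ∧ x' ∈ t} = {t | t ∈ KK y x ∧ x' ∉ t} := by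
    ext t; simp only [Set.mem_sdiff, Set.mem_ofPred_eq]; tauto
  rw [hL] at hDf ⊢
  have hmem : ∀ t, t ∈ {t | t ∈ KK y x ∧ x' ∉ t} ↔ (∀ q ∈ t, x < q) ∧
      IsChain (· ≤ ·) (↑t : Set P) ∧ (∃ q ∈ t, y ≤ q) ∧ x' ∉ t := by
    intro t
    simp only [KK, Set.mem_ofPred_eq, Finset.exists_mem_insert, hxy, false_or, and_assoc]
  have hms : ∀ t, t ∈ {t | t ∈ KK y x ∧ x' ∉ t} → mins x' t ∈ t ∧ x' < mins x' t ∧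
      ∀ z ∈ t, x' ≤ z → mins x' t ≤ z := by
    intro t ht
    obtain ⟨h1, h2, ⟨q, hq, hyq⟩, h4⟩ := (hmem t).1 ht
    obtain ⟨a, b, c⟩ := mins_spec (x' := x') h2 ⟨q, hq, hy.trans hyq⟩
    exact ⟨a, lt_of_le_of_ne b (fun h => h4 (h ▸ a)), c⟩
  have hlem : ∀ t, t ∈ {t | t ∈ KK y x ∧ x' ∉ t} → ∀ u ∈ t,
      t.erase u ∈ {t | t ∈ KK y x ∧ x' ∉ t} → mins x' t ≤ mins x' (t.erase u) := by
    intro t ht u hu hu'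
    exact (hms t ht).2.2 _ (Finset.mem_of_mem_erase (hms _ hu').1) (hms _ hu').2.1.le
  let r : Finset P → ℕ := fun s => (Finset.univ.filter (mins x' s ≤ ·)).card
  have hsub : ∀ {a b : P}, a ≤ b →
      Finset.univ.filter (b ≤ ·) ⊆ Finset.univ.filter (a ≤ ·) := by
    intro a b h q hq
    simp only [Finset.mem_filter, Finset.mem_univ, true_and] at hq ⊢
    exact h.trans hq
  have hinsmin : ∀ s, s ∈ {t | t ∈ KK y x ∧ x' ∉ t} →
      mins x' (insert (p (mins x' s)) s) = mins x' s := by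
    intro s hs
    obtain ⟨a, b, c⟩ := hms s hs
    obtain ⟨_, _, h3, _⟩ := hp _ b
    refine mins_eq (Finset.mem_insert_of_mem a) b.le fun z hz hxz => ?_
    rcases Finset.mem_insert.1 hz with rfl | hz
    · exact absurd hxz h3
    · exact c z hz hxz
  have hermin : ∀ t, t ∈ {t | t ∈ KK y x ∧ x' ∉ t} →
      mins x' (t.erase (p (mins x' t))) = mins x' t := by
    intro s hs
    obtain ⟨a, b, c⟩ := hms s hs
    obtain ⟨_, h2, h3, _⟩ := hp _ b
    exact mins_eq (Finset.mem_erase.2 ⟨h2.ne', a⟩) b.le fun z hz hxz =>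
      c z (Finset.mem_of_mem_erase hz) hxz
  refine acyclic_of_matching (L := {t | t ∈ KK y x ∧ x' ∉ t}) (fun s hs => hs.2.1) (KK_conv y x)
    (fun t ht => ht.1) r (fun s => p (mins x' s)) ?_ ?_ ?_ ?_ hij hf hDf
  · intro t ht u hu hK
    have hmem' : t.erase u ∈ {t | t ∈ KK y x ∧ x' ∉ t} :=
      ⟨hK, fun h => ht.2 (Finset.mem_of_mem_erase h)⟩
    exact ⟨hmem', Finset.card_le_card (hsub (hlem t ht u hu hmem'))⟩
  · intro t ht hv
    obtain ⟨a, b, c⟩ := hms t ht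
    obtain ⟨_, h2, h3, _⟩ := hp _ b
    refine ⟨?_, by simp only [r]; rw [hermin t ht]⟩
    obtain ⟨g1, g2, ⟨q, hq, hyq⟩, g4⟩ := (hmem t).1 ht
    refine (hmem _).2 ⟨fun q hq => g1 q (Finset.mem_of_mem_erase hq),
      g2.mono (by exact_mod_cast Finset.erase_subset _ _),
      ⟨q, Finset.mem_erase.2 ⟨?_, hq⟩, hyq⟩, fun h => g4 (Finset.mem_of_mem_erase h)⟩
    rintro rfl
    exact h3 (hy.trans hyq)
  · intro s hs hv
    obtain ⟨a, b, c⟩ := hms s hs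
    obtain ⟨h1, h2, h3, h4⟩ := hp _ b
    refine ⟨?_, by simp only [r]; rw [hinsmin s hs]⟩
    obtain ⟨g1, g2, ⟨q, hq, hyq⟩, g4⟩ := (hmem s).1 hs
    refine (hmem _).2 ⟨?_, ?_, ⟨q, Finset.mem_insert_of_mem hq, hyq⟩, ?_⟩
    · intro q hq
      rcases Finset.mem_insert.1 hq with rfl | hq
      · exact h1
      · exact g1 q hq
    · rw [Finset.coe_insert]
      refine g2.insert fun z hz _ => ?_
      have hz : z ∈ s := hz
      by_cases hxz : x' ≤ z
      · exact Or.inl (h2.le.trans (c z hz hxz))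
      · refine Or.inr (h4 z (g1 z hz) ?_ hxz)
        rcases g2.total hz a with h | h
        · exact h
        · exact absurd (b.le.trans h) hxz
    · intro h
      rcases Finset.mem_insert.1 h with h | h
      · exact h3 h.le
      · exact g4 h
  · intro t ht u hu hu' hr
    have h1 := hlem t ht u hu hu'
    have h2 := Finset.eq_of_subset_of_card_le (hsub h1) hr.ge
    have h3 : mins x' t ∈ Finset.univ.filter (mins x' (t.erase u) ≤ ·) := by
      rw [h2]; simp
    simp only [Finset.mem_filter, Finset.mem_univ, true_and] at h3
    change p _ = p _
    rw [le_antisymm h1 h3]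

theorem step_iso [OrderBot P] (hP : IsSimplicialPoset P) {x x' y : P} (hx : x ⋖ x')
    (hy : x' ≤ y) (i j : ℤ) (hij : j = i + 1) :
    Nonempty (Coh k P (KK y x') i ≃ₗ[k] Coh k P (KK y x) j) := by
  have hxy : ¬ y ≤ x := fun h => absurd (hx.lt.trans_le (hy.trans h)) (lt_irrefl x)
  have hgt : ∀ t ∈ KK y x, x' ∈ t → ∀ q ∈ t, q ≠ x' → x' < q := by
    intro t ht hxt q hq hne
    rcases ht.2.1.total hxt hq with h | h
    · exact lt_of_le_of_ne h hne.symm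
    · exact absurd (lt_of_le_of_ne h hne) (hx.2 (ht.1 q hq))
  have hψ : ∀ t ∈ {t | t ∈ KK y x ∧ x' ∈ t}, t.erase x' ∈ KK y x' ∧
      (t.card : ℤ) = (t.erase x').card + 1 ∧ insert x' (t.erase x') = t := by
    rintro t ⟨ht, hxt⟩
    refine ⟨⟨fun q hq => ?_, ht.2.1.mono (by exact_mod_cast Finset.erase_subset _ _), ?_⟩, ?_,
      Finset.insert_erase hxt⟩
    · obtain ⟨h1, h2⟩ := Finset.mem_erase.1 hq
      exact hgt t ht hxt q h2 h1
    · rw [Finset.insert_erase hxt]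
      obtain ⟨q, hq, hyq⟩ := ht.2.2
      rcases Finset.mem_insert.1 hq with rfl | hq
      · exact absurd hyq hxy
      · exact ⟨q, hq, hyq⟩
    · have := Finset.card_erase_add_one hxt
      omega
  have hφ : ∀ s ∈ KK y x', insert x' s ∈ {t | t ∈ KK y x ∧ x' ∈ t} ∧
      (insert x' s).erase x' = s := by
    intro s hs
    refine ⟨⟨⟨?_, ?_, ?_⟩, Finset.mem_insert_self _ _⟩, Finset.erase_insert ?_⟩
    · intro q hq
      rcases Finset.mem_insert.1 hq with rfl | hq
      · exact hx.lt
      · exact hx.lt.trans (hs.1 q hq)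
    · rw [Finset.coe_insert]
      exact hs.2.1.insert fun z hz _ => Or.inl (hs.1 z hz).le
    · obtain ⟨q, hq, hyq⟩ := hs.2.2
      exact ⟨q, Finset.mem_insert_of_mem hq, hyq⟩
    · intro h; exact lt_irrefl _ (hs.1 _ h)
  refine coh_iso (U := {t | t ∈ KK y x ∧ x' ∈ t}) (fun s hs => hs.2.1) (KK_conv y x)
    (fun t ht => ht.1) (fun t => t.erase x') (fun s => insert x' s) 1 hψ hφ (-1) (by simp) ?_
    (fun i j hij f hf hDf => step_acyclic hP hx hy hij hf hDf) i j hij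
  intro f hf
  funext t
  rw [Pi.smul_apply, extMap_apply]
  by_cases ht : t ∈ KK y x
  swap
  · rw [cDelta_apply_notMem ht, if_neg (fun h => ht h.1), smul_zero]
  by_cases hxt : x' ∈ t
  swap
  · rw [cDelta_apply_mem ht, if_neg (fun h => hxt h.2), smul_zero]
    refine Finset.sum_eq_zero fun v hv => ?_
    rw [extMap_apply, if_neg (fun h => hxt (Finset.mem_of_mem_erase h.2)), mul_zero]
  have htU : t ∈ {t | t ∈ KK y x ∧ x' ∈ t} := ⟨ht, hxt⟩
  rw [if_pos htU, cDelta_apply_mem ht, cDelta_apply_mem (hψ t htU).1, smul_eq_mul,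
    Finset.mul_sum, ← Finset.add_sum_erase _ _ hxt, extMap_apply,
    if_neg (fun h => absurd h.2 (Finset.notMem_erase _ _)), mul_zero, zero_add]
  refine Finset.sum_congr rfl fun v hv => ?_
  obtain ⟨hv1, hv2⟩ := Finset.mem_erase.1 hv
  have hE : extMap {t | t ∈ KK y x ∧ x' ∈ t} (fun t => t.erase x') f (t.erase v) =
      f ((t.erase x').erase v) := by
    rw [extMap_apply, Finset.erase_right_comm]
    split_ifs with h
    · rfl
    · by_contra hne
      have h1 := hφ _ (hf _ (Ne.symm hne))
      rw [Finset.erase_right_comm, Finset.insert_erase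
        (Finset.mem_erase.2 ⟨hv1.symm, hxt⟩)] at h1
      exact h h1.1
  have hF : (t.erase x').filter (fun u => u < v) = (t.filter fun u => u < v).erase x' := by
    ext w; simp only [Finset.mem_filter, Finset.mem_erase]; tauto
  have hm : x' ∈ t.filter fun u => u < v := by
    simp [hxt, hgt t ht hxt v hv2 hv1]
  rw [hE, hF, ← Finset.card_erase_add_one hm, pow_succ]
  ring

theorem link_iso (y : P) [Fintype (Set.Ici y)] (i : ℤ) :
    Nonempty (Coh k (Set.Ici y) (chainsK (Set.Ici y)) i ≃ₗ[k] Coh k P (KK y y) i) := by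
  have hmin : ∀ q : Set.Ici y, ¬ IsMin q ↔ y < q.1 := by
    intro q
    constructor
    · intro h
      refine lt_of_le_of_ne q.2 fun h' => h ?_
      intro b _
      change q.1 ≤ b.1
      rw [← h']; exact b.2
    · intro h hm
      have : q ≤ ⟨y, le_refl y⟩ := hm (b := ⟨y, le_refl y⟩) h.le
      exact absurd h (not_lt_of_ge this)
  let φ : Finset (Set.Ici y) → Finset P := fun s => s.map (Function.Embedding.subtype _)
  let ψ : Finset P → Finset (Set.Ici y) := fun t => t.subtype (· ∈ Set.Ici y)
  have hψφ : ∀ s, ψ (φ s) = s := by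
    intro s; ext a; simp only [ψ, φ, Finset.mem_subtype]; simp; exact fun _ => a.2
  have hφψ : ∀ t ∈ KK y y, φ (ψ t) = t := by
    intro t ht
    ext a
    simp only [ψ, φ, Finset.subtype_map, Finset.mem_filter, and_iff_left_iff_imp]
    exact fun h => (ht.1 a h).le
  have hφK : ∀ s, φ s ∈ KK y y ↔ s ∈ chainsK (Set.Ici y) := by
    intro s
    constructor
    · intro h
      refine ⟨fun q hq => (hmin q).2 (h.1 q.1 (Finset.mem_map_of_mem _ hq)), ?_⟩
      intro a ha b hb hab
      exact h.2.1 (Finset.mem_coe.2 (Finset.mem_map_of_mem _ ha))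
        (Finset.mem_coe.2 (Finset.mem_map_of_mem _ hb)) (fun h => hab (Subtype.ext h))
    · intro h
      refine ⟨fun q hq => ?_, ?_, y, Finset.mem_insert_self _ _, le_rfl⟩
      · obtain ⟨a, ha, rfl⟩ := Finset.mem_map.1 hq
        exact (hmin a).1 (h.1 a ha)
      · intro a ha b hb hab
        obtain ⟨a, ha', rfl⟩ := Finset.mem_map.1 (Finset.mem_coe.1 ha)
        obtain ⟨b, hb', rfl⟩ := Finset.mem_map.1 (Finset.mem_coe.1 hb)
        exact h.2 ha' hb' (fun h => hab (by rw [h]))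
  refine coh_iso (U := KK y y) (fun s hs => hs.2.1) (KK_conv y y) (fun t ht => ht) ψ φ 0 ?_
    (fun s hs => ⟨(hφK s).2 hs, hψφ s⟩) 1 one_ne_zero ?_ ?_ i i (by simp)
  · intro t ht
    refine ⟨(hφK _).1 (by rwa [hφψ t ht]), ?_, hφψ t ht⟩
    conv_lhs => rw [← hφψ t ht]
    simp [φ]
  · intro f hf
    funext t
    rw [one_smul, extMap_apply]
    by_cases ht : t ∈ KK y y
    swap
    · rw [cDelta_apply_notMem ht, if_neg ht]
    obtain ⟨s, rfl⟩ : ∃ s, t = φ s := ⟨ψ t, (hφψ t ht).symm⟩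
    rw [if_pos ht, hψφ, cDelta_apply_mem ht, cDelta_apply_mem ((hφK s).1 ht), Finset.sum_map]
    refine Finset.sum_congr rfl fun v hv => ?_
    have h1 : (φ s).erase (Function.Embedding.subtype _ v) = φ (s.erase v) :=
      (Finset.map_erase _ _ _).symm
    have h2 : φ (s.erase v) ∈ KK y y := by
      rw [hφK]
      have := (hφK s).1 ht
      exact ⟨fun q hq => this.1 q (Finset.mem_of_mem_erase hq),
        this.2.mono (by exact_mod_cast Finset.erase_subset _ _)⟩
    rw [h1, extMap_apply, if_pos h2, hψφ]
    congr 2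
    · simp only [φ, Finset.filter_map, Finset.card_map]
      rfl
    · congr
      exact Subsingleton.elim _ _
  · intro i j _ f _ _
    exact ⟨0, Submodule.zero_mem _, fun s hs => absurd hs.1 hs.2⟩

theorem KK_bot [OrderBot P] (y : P) (hy : y ≠ ⊥) : KK y ⊥ = relK P (cost y) := by
  ext s
  simp only [KK, relK, chainsK, cost, Set.mem_ofPred_eq, Finset.exists_mem_insert, le_bot_iff, hy,
    false_or, and_assoc, isMin_iff_eq_bot, bot_lt_iff_ne_bot, Set.not_subset, not_not,
    Finset.mem_coe, ne_eq]

theorem flag_iso [OrderBot P] (hP : IsSimplicialPoset P) (y : P) (m : ℕ)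
    (e : Set.Icc (⊥ : P) y ≃o Finset (Fin m)) (X : Finset (Fin m)) (j : ℤ) :
    Nonempty (Coh k P (KK y (e.symm X).1) (j - X.card) ≃ₗ[k] Coh k P (KK y ⊥) j) := by
  induction X using Finset.induction_on generalizing j with
  | empty =>
    have : (e.symm ∅).1 = ⊥ := by
      have h : e.symm ∅ ≤ ⟨⊥, le_rfl, bot_le⟩ := by
        rw [e.symm_apply_le]; exact Finset.empty_subset _
      exact le_bot_iff.1 h
    rw [this]
    rw [show j - ((∅ : Finset (Fin m)).card : ℤ) = j by simp]
    exact ⟨LinearEquiv.refl _ _⟩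
  | insert a X ha ih =>
    obtain ⟨g⟩ := ih j
    have hcov : e.symm X ⋖ e.symm (insert a X) := by
      rw [apply_covBy_apply_iff e.symm]
      exact Finset.covBy_insert ha
    have hcov' : (e.symm X).1 ⋖ (e.symm (insert a X)).1 := by
      refine ⟨hcov.1, fun c h1 h2 => ?_⟩
      exact hcov.2 (c := ⟨c, bot_le, h2.le.trans (e.symm (insert a X)).2.2⟩) h1 h2
    obtain ⟨g'⟩ := step_iso (k := k) hP hcov' (e.symm (insert a X)).2.2
      (j - (insert a X).card) (j - X.card) (by
        rw [Finset.card_insert_of_notMem ha]; push_cast; ring)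
    exact ⟨g'.trans g⟩

theorem ncard_atoms [OrderBot P] (y : P) (m : ℕ)
    (e : Set.Icc (⊥ : P) y ≃o Finset (Fin m)) : {a : P | IsAtom a ∧ a ≤ y}.ncard = m := by
  letI : OrderBot (Set.Icc (⊥ : P) y) :=
    { bot := ⟨⊥, le_rfl, bot_le⟩, bot_le := fun a => a.2.1 }
  have hat : ∀ z : Set.Icc (⊥ : P) y, IsAtom z.1 ↔ ∃ i, e z = {i} := by
    intro z
    rw [← Finset.isAtom_iff, OrderIso.isAtom_iff]
    constructor
    · intro h
      refine ⟨fun h' => h.1 (congrArg Subtype.val h'), fun b hb => ?_⟩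
      exact Subtype.ext (h.2 b.1 hb)
    · intro h
      refine ⟨fun h' => h.1 (Subtype.ext h'), fun b hb => ?_⟩
      exact congrArg Subtype.val (h.2 ⟨b, bot_le, hb.le.trans z.2.2⟩ hb)
  have himg : {a : P | IsAtom a ∧ a ≤ y} = (fun i : Fin m => (e.symm {i}).1) '' Set.univ := by
    ext a
    simp only [Set.mem_ofPred_eq, Set.image_univ, Set.mem_range]
    constructor
    · rintro ⟨h1, h2⟩
      obtain ⟨i, hi⟩ := (hat ⟨a, bot_le, h2⟩).1 h1
      exact ⟨i, by rw [← hi]; simp⟩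
    · rintro ⟨i, rfl⟩
      exact ⟨(hat _).2 ⟨i, by simp⟩, (e.symm {i}).2.2⟩
  rw [himg, Set.ncard_image_of_injective, Set.ncard_univ, Nat.card_eq_fintype_card, Fintype.card_fin]
  intro i j h
  have h1 := e.symm.injective (Subtype.ext h)
  simpa using h1

end Concrete

/-- Lemma 4.1: for a face `y ≠ ⊥` of a simplicial poset `P`,
`H̃^{i - |supp y| - 1}(lk_P y) ≅ H^{i-1}(P, cost_P y)` (coefficients in the field `k`). -/
theorem link_contrastar_cohomology_iso (P : Type) [Fintype P] [PartialOrder P] [OrderBot P]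
    (hP : IsSimplicialPoset P) (y : P) (hy : y ≠ ⊥) (i : ℤ) :
    Nonempty
      (ReducedCoh k (Set.Ici y) (i - ({a : P | IsAtom a ∧ a ≤ y}.ncard : ℤ) - 1) ≃ₗ[k]
        RelCoh k P (cost y) (i - 1)) := by
  obtain ⟨m, ⟨e⟩⟩ := hP y
  have htop : (e.symm Finset.univ).1 = y := by
    have h : (⟨y, bot_le, le_rfl⟩ : Set.Icc ⊥ y) ≤ e.symm Finset.univ := by
      rw [e.le_symm_apply]; exact Finset.subset_univ _
    exact le_antisymm (e.symm Finset.univ).2.2 h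
  obtain ⟨g1⟩ := link_iso (k := k) y (i - ({a : P | IsAtom a ∧ a ≤ y}.ncard : ℤ) - 1)
  obtain ⟨g2⟩ := flag_iso (k := k) hP y m e Finset.univ (i - 1)
  rw [htop, KK_bot y hy, Finset.card_univ, Fintype.card_fin,
    show i - 1 - (m : ℤ) = i - ({a : P | IsAtom a ∧ a ≤ y}.ncard : ℤ) - 1 by
      rw [ncard_atoms y m e]; ring] at g2
  exact ⟨g1.trans g2⟩

end
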